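/- (Substitution Theorem) Let K be a one-relator group given by an ordinary presentation ⟨y, z; S(y,z)⟩ (y a set, z a single generator not in y, S a word on y ∪ {z}), and let P = ⟨x, H; R⟩ be an M_H-presentation. Then the group defined by the relative presentation ⟨x, y, H; S(y, R)⟩, obtained by substituting the relator R for every occurrence of z^{±1} in S, is residually finite if and only if both H and K are residually finite. -/

import Mathlib

open Monoid

section Defs
variable {X Y H : Type*}

/-- `φ_W^θ(j)`: the sum `Σ_{i=1}^{j} ε_i θ(x_i)` of the weights of the first `j`
letters of the word `W` (a word is a nonempty list of pairs (letter, exponent sign)). -/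
def phiW (θ : X → ℤ) (W : List (X × Bool)) (j : ℕ) : ℤ :=
  ((W.take j).map fun p => if p.2 then θ p.1 else -θ p.1).sum

/-- A weight function: a map `θ : X → ℤ` whose image generates the additive group `ℤ`. -/
def IsWeightFun (θ : X → ℤ) : Prop :=
  AddSubgroup.closure (Set.range θ) = ⊤

/-- A strict weight function: `θ x ≠ 0` for all `x`. -/
def IsStrictWeight (θ : X → ℤ) : Prop := ∀ x, θ x ≠ 0

/-- `θ` is admissible for `W` if `φ(r) = 0` where `r` is the length of `W`. -/
def IsAdmissible (θ : X → ℤ) (W : List (X × Bool)) : Prop :=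
  phiW θ W W.length = 0

/-- The successor of an index, cyclically (subscripts mod `r`). -/
def succIdx (W : List (X × Bool)) (k : Fin W.length) : Fin W.length :=
  ⟨(k.1 + 1) % W.length, Nat.mod_lt _ k.pos⟩

/-- `W` has the unique max-min property with respect to the weight function `θ`:
`θ` is a strict weight function, admissible for `W`, the graph of `W` has a unique
maximum at `k` and a unique minimum at `l`, and `W` is reduced at the maximum and
minimum (`x_k ≠ x_{k+1}`, `x_l ≠ x_{l+1}`, subscripts mod `r`). -/
def UniqueMaxMinWith (θ : X → ℤ) (W : List (X × Bool)) : Prop :=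
  W ≠ [] ∧ IsWeightFun θ ∧ IsStrictWeight θ ∧ IsAdmissible θ W ∧
  ∃ k l : Fin W.length,
    (∀ j : Fin W.length, j ≠ k → phiW θ W (j.1 + 1) < phiW θ W (k.1 + 1)) ∧
    (∀ j : Fin W.length, j ≠ l → phiW θ W (l.1 + 1) < phiW θ W (j.1 + 1)) ∧
    (W.get k).1 ≠ (W.get (succIdx W k)).1 ∧
    (W.get l).1 ≠ (W.get (succIdx W l)).1

/-- `W` has the unique max-min property: it has it with respect to some
admissible strict weight function. -/
def HasUniqueMaxMin (W : List (X × Bool)) : Prop :=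
  ∃ θ : X → ℤ, UniqueMaxMinWith θ W

/-- The `x`-skeleton of a relator `R = x₁^{ε₁} h₁ ⋯ x_r^{ε_r} h_r`
(encoded as the list of triples `(xᵢ, εᵢ, hᵢ)`): the word `x₁^{ε₁} ⋯ x_r^{ε_r}`. -/
def skel (R : List (X × Bool × H)) : List (X × Bool) :=
  R.map fun t => (t.1, t.2.1)

variable [Group H]

/-- The element of the free product `H ∗ F(X)` represented by the relator
`R = x₁^{ε₁} h₁ ⋯ x_r^{ε_r} h_r`. -/
def relWord (R : List (X × Bool × H)) : Coprod H (FreeGroup X) :=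
  (R.map fun t => Coprod.inr (FreeGroup.mk [(t.1, t.2.1)]) * Coprod.inl t.2.2).prod

/-- The group `G(P)` defined by the relative one-relator presentation
`P = ⟨x, H; R⟩`: the quotient of `H ∗ F(X)` by the normal closure of `R`. -/
def relGroup (R : List (X × Bool × H)) : Type _ :=
  Coprod H (FreeGroup X) ⧸ Subgroup.normalClosure {relWord R}

instance (R : List (X × Bool × H)) : Group (relGroup R) :=
  QuotientGroup.Quotient.group _

/-- The natural homomorphism `ν : H → G(P)`. -/
def natHom (R : List (X × Bool × H)) : H →* relGroup R :=
  (QuotientGroup.mk' _).comp Coprod.inl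

end Defs

/-- A group is residually finite if every nontrivial element is sent to a
nontrivial element by some homomorphism to a finite group. -/
def ResiduallyFinite (G : Type*) [Group G] : Prop :=
  ∀ g : G, g ≠ 1 → ∃ (Q : Type) (_ : Group Q) (_ : Finite Q) (f : G →* Q), f g ≠ 1

section Subst
variable {X Y H : Type*} [Group H]

/-- The embedding `H ∗ F(X) → H ∗ F(X ⊔ Y)` induced by the inclusion `X → X ⊔ Y`. -/
def coprodInlX : Coprod H (FreeGroup X) →* Coprod H (FreeGroup (X ⊕ Y)) :=
  Coprod.map (MonoidHom.id H) (FreeGroup.map Sum.inl)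

/-- Given a relator `R` on `x^{±1} ∪ H` and a word `S = S(y,z)` on `(y ∪ {z})^{±1}`
(the letter `z` is encoded as `none`, and `y ∈ y` as `some y`), the element of
`H ∗ F(X ⊔ Y)` represented by the word `S(y, R)` obtained from `S` by substituting
`R^{±1}` for every occurrence of `z^{±1}`. -/
def substWord (R : List (X × Bool × H)) (S : List (Option Y × Bool)) :
    Coprod H (FreeGroup (X ⊕ Y)) :=
  (S.map fun p => match p.1 with
    | none => if p.2 then coprodInlX (relWord R) else (coprodInlX (relWord R))⁻¹
    | some y => Coprod.inr (FreeGroup.mk [(Sum.inr y, p.2)])).prod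

/-- The group defined by the relative presentation `⟨x, y, H; S(y, R)⟩`. -/
def substGroup (R : List (X × Bool × H)) (S : List (Option Y × Bool)) : Type _ :=
  Coprod H (FreeGroup (X ⊕ Y)) ⧸ Subgroup.normalClosure {substWord R S}

instance (R : List (X × Bool × H)) (S : List (Option Y × Bool)) :
    Group (substGroup R S) := QuotientGroup.Quotient.group _

end Subst

/-- The one-relator group `K = ⟨y, z; S(y,z)⟩` given by an ordinary presentation
with a single relator `S`, a word on the alphabet `y ∪ {z}` (the letter `z` is
encoded as `none`). -/
def oneRelatorGroup {Y : Type*} (S : List (Option Y × Bool)) : Type _ :=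
  FreeGroup (Option Y) ⧸ Subgroup.normalClosure {FreeGroup.mk S}

instance {Y : Type*} (S : List (Option Y × Bool)) : Group (oneRelatorGroup S) :=
  QuotientGroup.Quotient.group _

section FreeProducts

universe u v

theorem ResiduallyFinite.of_injective {G G' : Type*} [Group G] [Group G'] (f : G →* G')
    (hf : Function.Injective f) (h : ResiduallyFinite G') : ResiduallyFinite G := by
  intro g hg
  obtain ⟨Q, i1, i2, p, hp⟩ := h (f g) (by simpa using hf.ne hg)
  exact ⟨Q, i1, i2, p.comp f, hp⟩

/-- An involution of `Fin (k + 1) × Q` which, for every `j < k` with label `lab j = i`,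
exchanges the points `(j, 1)` and `(j + 1, c j)`. -/
noncomputable def chainSwap {ι Q : Type*} [Group Q] {k : ℕ} (lab : Fin k → ι) (c : Fin k → Q)
    (i : ι) (p : Fin (k + 1) × Q) : Fin (k + 1) × Q :=
  open Classical in
  if h : ∃ j : Fin k, lab j = i ∧ p = (j.castSucc, 1) then (h.choose.succ, c h.choose)
  else if h : ∃ j : Fin k, lab j = i ∧ p = (j.succ, c j) then (h.choose.castSucc, 1)
  else p

section
variable {ι Q : Type*} [Group Q] {k : ℕ} {lab : Fin k → ι} {c : Fin k → Q}

theorem chainSwap_castSucc (j : Fin k) :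
    chainSwap lab c (lab j) (j.castSucc, 1) = (j.succ, c j) := by
  have h : ∃ j' : Fin k, lab j' = lab j ∧ ((j.castSucc, 1) : Fin (k + 1) × Q) = (j'.castSucc, 1) :=
    ⟨j, rfl, rfl⟩
  have h2 : h.choose = j := by
    have := (Prod.ext_iff.1 h.choose_spec.2).1
    simp only [Fin.castSucc_inj] at this
    exact this.symm
  rw [chainSwap, dif_pos h, h2]

theorem chainSwap_succ (hc : ∀ j, c j ≠ 1) (j : Fin k) :
    chainSwap lab c (lab j) (j.succ, c j) = (j.castSucc, 1) := by
  have h0 : ¬ ∃ j' : Fin k, lab j' = lab j ∧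
      ((j.succ, c j) : Fin (k + 1) × Q) = (j'.castSucc, 1) := by
    rintro ⟨j', -, h⟩
    exact hc j (Prod.ext_iff.1 h).2
  have h : ∃ j' : Fin k, lab j' = lab j ∧ ((j.succ, c j) : Fin (k + 1) × Q) = (j'.succ, c j') :=
    ⟨j, rfl, rfl⟩
  have h2 : h.choose = j := by
    have := (Prod.ext_iff.1 h.choose_spec.2).1
    simp only [Fin.succ_inj] at this
    exact this.symm
  rw [chainSwap, dif_neg h0, dif_pos h, h2]

theorem chainSwap_involutive (hc : ∀ j, c j ≠ 1) (i : ι) :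
    Function.Involutive (chainSwap lab c i) := by
  intro p
  by_cases h : ∃ j : Fin k, lab j = i ∧ p = (j.castSucc, 1)
  · obtain ⟨j, rfl, rfl⟩ := h
    rw [chainSwap_castSucc, chainSwap_succ hc]
  by_cases h' : ∃ j : Fin k, lab j = i ∧ p = (j.succ, c j)
  · obtain ⟨j, rfl, rfl⟩ := h'
    rw [chainSwap_succ hc, chainSwap_castSucc]
  have : chainSwap lab c i p = p := by rw [chainSwap, dif_neg h, dif_neg h']
  rw [this, this]

theorem chainSwap_eq_self {i : ι} {p : Fin (k + 1) × Q}
    (h : ∀ j, lab j = i → p ≠ (j.castSucc, 1)) (h' : ∀ j, lab j = i → p ≠ (j.succ, c j)) :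
    chainSwap lab c i p = p := by
  rw [chainSwap, dif_neg (by rintro ⟨j, h1, h2⟩; exact h j h1 h2),
    dif_neg (by rintro ⟨j, h1, h2⟩; exact h' j h1 h2)]

/-- The translation action of `Q` on the second factor of `A × Q`. -/
def translateSnd (A Q : Type*) [Group Q] : Q →* Equiv.Perm (A × Q) where
  toFun q := Equiv.prodCongr (Equiv.refl A) (Equiv.mulLeft q)
  map_one' := by ext <;> simp
  map_mul' a b := by ext <;> simp [mul_assoc]

/-- The action of `Q` on `Fin (k + 1) × Q` attached to the label `i`; it maps `(j + 1, 1)`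
to `(j, 1)` through `c j` whenever `lab j = i`. -/
noncomputable def chainAction (lab : Fin k → ι) (c : Fin k → Q) (hc : ∀ j, c j ≠ 1) (i : ι) :
    Q →* Equiv.Perm (Fin (k + 1) × Q) :=
  (MulAut.conj ((chainSwap_involutive (lab := lab) hc i).toPerm)).toMonoidHom.comp
    (translateSnd (Fin (k + 1)) Q)

theorem chainAction_apply (hc : ∀ j, c j ≠ 1)
    (hlab : ∀ j j' : Fin k, j.1 + 1 = j'.1 → lab j ≠ lab j') (j : Fin k) :
    chainAction lab c hc (lab j) (c j) (j.succ, 1) = (j.castSucc, 1) := by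
  have h1 : chainSwap lab c (lab j) (j.succ, 1) = (j.succ, 1) := by
    apply chainSwap_eq_self
    · intro j' hj' h
      have := congrArg Fin.val (Prod.ext_iff.1 h).1
      exact hlab j j' (by simpa using this) hj'.symm
    · intro j' _ h
      exact hc j' (Prod.ext_iff.1 h).2.symm
  have h2 : ((chainSwap_involutive (lab := lab) hc (lab j)).toPerm)⁻¹ (j.succ, 1)
      = (j.succ, 1) := h1
  simp only [chainAction, MonoidHom.comp_apply, MulEquiv.toMonoidHom_eq_coe, MonoidHom.coe_coe,
    MulAut.conj_apply, Equiv.Perm.mul_apply, h2]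
  simp [translateSnd, chainSwap_succ hc]

end

theorem residuallyFinite_coprodI {ι : Type*} {M : ι → Type*} [∀ i, Group (M i)]
    (hM : ∀ i, ResiduallyFinite (M i)) : ResiduallyFinite (CoprodI M) := by
  classical
  intro g hg
  obtain ⟨w, rfl⟩ : ∃ w : CoprodI.Word M, w.prod = g :=
    ⟨CoprodI.Word.equiv g, CoprodI.Word.equiv.symm_apply_apply g⟩
  obtain ⟨l, hl1, hl2⟩ := w
  simp only [CoprodI.Word.prod] at hg ⊢
  have hl0 : l.length ≠ 0 := by
    intro h
    rw [List.length_eq_zero_iff] at h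
    simp [h] at hg
  choose Q iG iF f hf using fun j : Fin l.length => hM _ (l.get j).2 (hl1 _ (l.get_mem j))
  let ρ : ∀ i, M i →* (∀ j, Q j) := fun i => MonoidHom.mk'
    (fun m j => if h : i = (l.get j).1 then f j (h ▸ m) else 1) (by
      intro a b
      ext j
      by_cases h : i = (l.get j).1
      · subst h
        simp
      · simp only [Pi.mul_apply, dif_neg h, mul_one])
  let lab : Fin l.length → ι := fun j => (l.get j).1
  let c : Fin l.length → ∀ j, Q j := fun j => ρ _ (l.get j).2
  have hc : ∀ j, c j ≠ 1 := by
    intro j h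
    have := congrFun h j
    simp only [c, ρ, MonoidHom.mk'_apply, dite_true, Pi.one_apply] at this
    exact hf j this
  have hlab : ∀ j j' : Fin l.length, j.1 + 1 = j'.1 → lab j ≠ lab j' := by
    intro j j' h
    have := (List.isChain_iff_getElem.1 hl2) j.1 (by omega)
    simpa [lab, h] using this
  let τ : CoprodI M →* Equiv.Perm (Fin (l.length + 1) × (∀ j, Q j)) :=
    CoprodI.lift fun i => (chainAction lab c hc i).comp (ρ i)
  refine ⟨_, inferInstance, inferInstance, τ, fun h => ?_⟩
  have key : ∀ n (hn : n ≤ l.length),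
      τ ((l.drop (l.length - n)).map fun x => CoprodI.of x.2).prod (Fin.last _, 1)
        = (⟨l.length - n, by omega⟩, 1) := by
    intro n
    induction n with
    | zero => intro _; simp; rfl
    | succ n ih =>
      intro hn
      have hlt : l.length - (n + 1) < l.length := by omega
      have e : l.length - (n + 1) + 1 = l.length - n := by omega
      rw [List.drop_eq_getElem_cons hlt, List.map_cons, List.prod_cons, map_mul,
        Equiv.Perm.mul_apply, e, ih (by omega)]
      have := chainAction_apply hc hlab ⟨l.length - (n + 1), hlt⟩
      simp only [Fin.succ_mk, e, Fin.castSucc_mk] at this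
      simp only [τ, CoprodI.lift_of]
      exact this
  have h2 := key l.length le_rfl
  have h3 := congrArg Fin.val (Prod.ext_iff.1 h2).1
  simp only [Nat.sub_self, List.drop_zero, h, Equiv.Perm.one_apply, Fin.val_last] at h3
  exact hl0 h3

theorem residuallyFinite_multiplicative_int : ResiduallyFinite (Multiplicative ℤ) := by
  intro g hg
  refine ⟨Multiplicative (ZMod (g.toAdd.natAbs + 1)), inferInstance, inferInstance,
    (Int.castAddHom (ZMod (g.toAdd.natAbs + 1))).toMultiplicative, fun h => hg ?_⟩
  have h1 : ((g.toAdd : ℤ) : ZMod (g.toAdd.natAbs + 1)) = 0 := h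
  rw [ZMod.intCast_zmod_eq_zero_iff_dvd] at h1
  have h2 : g.toAdd = 0 := Int.eq_zero_of_abs_lt_dvd h1 (by
    rw [Int.abs_eq_natAbs]; push_cast; omega)
  exact h2

theorem residuallyFinite_freeGroup (X : Type*) : ResiduallyFinite (FreeGroup X) := by
  let φ : FreeGroup X →* CoprodI fun _ : X => Multiplicative ℤ :=
    FreeGroup.lift fun x => CoprodI.of (i := x) (Multiplicative.ofAdd 1)
  let ψ : (CoprodI fun _ : X => Multiplicative ℤ) →* FreeGroup X :=
    CoprodI.lift fun x => zpowersHom _ (FreeGroup.of x)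
  have h : ψ.comp φ = MonoidHom.id _ := by
    ext x
    simp [φ, ψ]
  exact .of_injective φ (Function.LeftInverse.injective (g := ψ) (DFunLike.congr_fun h))
    (residuallyFinite_coprodI fun _ => residuallyFinite_multiplicative_int)

theorem ResiduallyFinite.coprod {G : Type u} {G' : Type v} [Group G] [Group G']
    (h : ResiduallyFinite G) (h' : ResiduallyFinite G') : ResiduallyFinite (Coprod G G') := by
  let M : Bool → Type (max u v) := fun b => match b with
    | true => ULift.{v} G
    | false => ULift.{u} G'
  let _ : ∀ b, Group (M b) := fun b => match b with
    | true => inferInstanceAs (Group (ULift.{v} G))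
    | false => inferInstanceAs (Group (ULift.{u} G'))
  have hM : ∀ b, ResiduallyFinite (M b) := fun b => match b with
    | true => .of_injective (MulEquiv.ulift (α := G)).toMonoidHom MulEquiv.ulift.injective h
    | false => .of_injective (MulEquiv.ulift (α := G')).toMonoidHom MulEquiv.ulift.injective h'
  let φ : Coprod G G' →* CoprodI M := Coprod.lift
    ((CoprodI.of (M := M) (i := true)).comp (MulEquiv.ulift (α := G)).symm.toMonoidHom)
    ((CoprodI.of (M := M) (i := false)).comp (MulEquiv.ulift (α := G')).symm.toMonoidHom)
  let ψ : CoprodI M →* Coprod G G' := CoprodI.lift fun b => match b with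
    | true => Coprod.inl.comp (MulEquiv.ulift (α := G)).toMonoidHom
    | false => Coprod.inr.comp (MulEquiv.ulift (α := G')).toMonoidHom
  have hc : ψ.comp φ = MonoidHom.id _ := by
    apply Coprod.hom_ext
    · ext g
      simp only [φ, ψ, MonoidHom.comp_apply, Coprod.lift_apply_inl, CoprodI.lift_of]
      rfl
    · ext g
      simp only [φ, ψ, MonoidHom.comp_apply, Coprod.lift_apply_inr, CoprodI.lift_of]
      rfl
  exact .of_injective φ (Function.LeftInverse.injective (g := ψ) (DFunLike.congr_fun hc))
    (residuallyFinite_coprodI hM)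

end FreeProducts

section Paths

variable {X H I Γ : Type*} [Group H] [AddCommGroup I] [Group Γ]

/-- The source of the edge of the Cayley-type graph on `I` traversed by the letter `x ^ ε`
starting from the vertex `n`, where an edge labelled `x` leads from `i` to `i + θ x`. -/
def edgeSource (θ : X → I) (n : I) (x : X) (ε : Bool) : I := if ε then n else n - θ x

/-- The edges traversed by a path with the given letters starting from the vertex `n`. -/
def pathEdges (θ : X → I) : I → List (X × Bool × H) → List (X × I)
  | _, [] => []
  | n, t :: L => (t.1, edgeSource θ n t.1 t.2.1) ::
      pathEdges θ (n + if t.2.1 then θ t.1 else -θ t.1) L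

/-- The value of a path starting at the vertex `n`, when the edge labelled `x` starting at `i`
has value `D x i` and the elements of `H` are evaluated by `f`. -/
def pathVal (θ : X → I) (D : X → I → Γ) (f : H →* Γ) : I → List (X × Bool × H) → Γ
  | _, [] => 1
  | n, t :: L =>
      (if t.2.1 then D t.1 (edgeSource θ n t.1 t.2.1)
        else (D t.1 (edgeSource θ n t.1 t.2.1))⁻¹) * f t.2.2 *
      pathVal θ D f (n + if t.2.1 then θ t.1 else -θ t.1) L

/-- The total weight of the skeleton of a word. -/
def pathWeight (θ : X → I) (L : List (X × Bool × H)) : I :=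
  (L.map fun t => if t.2.1 then θ t.1 else -θ t.1).sum

theorem pathVal_congr {θ : X → I} {D D' : X → I → Γ} {f : H →* Γ} {n : I}
    {L : List (X × Bool × H)} (h : ∀ p ∈ pathEdges θ n L, D p.1 p.2 = D' p.1 p.2) :
    pathVal θ D f n L = pathVal θ D' f n L := by
  induction L generalizing n with
  | nil => rfl
  | cons t L ih =>
    simp only [pathEdges, List.forall_mem_cons] at h
    simp only [pathVal, h.1, ih h.2]

theorem pathVal_add_right (θ : X → I) (D : X → I → Γ) (f : H →* Γ) (n m : I)
    (L : List (X × Bool × H)) :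
    pathVal θ D f (n + m) L = pathVal θ (fun x i => D x (i + m)) f n L := by
  induction L generalizing n with
  | nil => rfl
  | cons t L ih =>
    have h : edgeSource θ (n + m) t.1 t.2.1 = edgeSource θ n t.1 t.2.1 + m := by
      simp only [edgeSource]
      split
      · rfl
      · exact add_sub_right_comm n m _
    rw [pathVal, pathVal, h, add_right_comm, ih]

theorem map_pathVal {Γ' : Type*} [Group Γ'] (π : Γ →* Γ') (θ : X → I) (D : X → I → Γ)
    (f : H →* Γ) (n : I) (L : List (X × Bool × H)) :
    π (pathVal θ D f n L) = pathVal θ (fun x i => π (D x i)) (π.comp f) n L := by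
  induction L generalizing n with
  | nil => simp [pathVal]
  | cons t L ih => simp [pathVal, ih, apply_ite π]

theorem pathVal_const (π : Coprod H (FreeGroup X) →* Γ) (θ : X → I) (n : I)
    (L : List (X × Bool × H)) :
    pathVal θ (fun x _ => π (Coprod.inr (FreeGroup.of x))) (π.comp Coprod.inl) n L =
      π (relWord L) := by
  induction L generalizing n with
  | nil => simp [pathVal, relWord]
  | cons t L ih =>
    rw [pathVal, ih, relWord, relWord, List.map_cons, List.prod_cons, map_mul, map_mul]
    obtain ⟨x, ε, h⟩ := t
    cases ε
    · have : (FreeGroup.mk [(x, false)]) = (FreeGroup.of x)⁻¹ := rfl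
      simp [this]
    · rfl

theorem pathVal_intCast (N : ℕ) (θ : X → ℤ) (D : X → ℤ → Γ) (D' : X → ZMod N → Γ)
    (hD : ∀ x n, D' x (n : ℤ) = D x n) (f : H →* Γ) (n : ℤ) (L : List (X × Bool × H)) :
    pathVal (fun x => (θ x : ZMod N)) D' f n L = pathVal θ D f n L := by
  induction L generalizing n with
  | nil => rfl
  | cons t L ih =>
    obtain ⟨x, ε, h⟩ := t
    cases ε
    · simp only [pathVal, edgeSource, Bool.false_eq_true, if_false]
      rw [← ih, ← hD]
      push_cast
      rfl
    · simp only [pathVal, edgeSource, if_true]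
      rw [← ih, ← hD]
      push_cast
      rfl

omit [Group H] in
theorem pathWeight_intCast (N : ℕ) (θ : X → ℤ) (L : List (X × Bool × H)) :
    pathWeight (fun x => (θ x : ZMod N)) L = (pathWeight θ L : ℤ) := by
  induction L with
  | nil => simp [pathWeight]
  | cons t L ih =>
    simp only [pathWeight, List.map_cons, List.sum_cons] at ih ⊢
    rw [ih]
    split <;> push_cast <;> rfl

omit [Group H] in
theorem pathEdges_eq_map (θ : X → I) (n : I) (L : List (X × Bool × H)) :
    pathEdges θ n L = (pathEdges θ 0 L).map fun p => (p.1, n + p.2) := by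
  induction L generalizing n with
  | nil => rfl
  | cons t L ih =>
    simp only [pathEdges, List.map_cons, List.cons.injEq]
    refine ⟨?_, ?_⟩
    · simp only [edgeSource]
      split <;> simp [sub_eq_add_neg]
    · rw [ih, ih (0 + _), List.map_map]
      congr 1
      funext p
      simp [add_assoc]

/-- If a path traverses an edge exactly once, its value depends on the value at this edge through
two translations and possibly an inversion. -/
theorem exists_pathVal_eq {θ : X → I} (D : Γ → X → I → Γ) (f : H →* Γ) {n : I}
    {L : List (X × Bool × H)} {E₁ E₂ : List (X × I)} {e : X × I}
    (hL : pathEdges θ n L = E₁ ++ e :: E₂) (he : ∀ g, D g e.1 e.2 = g)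
    (hE₁ : ∀ p ∈ E₁, ∀ g, D g p.1 p.2 = D 1 p.1 p.2)
    (hE₂ : ∀ p ∈ E₂, ∀ g, D g p.1 p.2 = D 1 p.1 p.2) :
    ∃ (a b : Γ) (ε : Bool), ∀ g, pathVal θ (D g) f n L = a * (if ε then g else g⁻¹) * b := by
  induction L generalizing n E₁ with
  | nil => simp [pathEdges] at hL
  | cons t L ih =>
    cases E₁ with
    | nil =>
      simp only [pathEdges, List.nil_append, List.cons.injEq] at hL
      obtain ⟨h1, h2⟩ := hL
      refine ⟨1, f t.2.2 * pathVal θ (D 1) f (n + if t.2.1 then θ t.1 else -θ t.1) L, t.2.1, ?_⟩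
      intro g
      rw [pathVal, pathVal_congr (D' := D 1) (fun p hp => hE₂ p (h2 ▸ hp) g)]
      have : D g t.1 (edgeSource θ n t.1 t.2.1) = g := by
        rw [← h1] at he
        exact he g
      rw [this, one_mul, mul_assoc]
    | cons e' E₁ =>
      simp only [pathEdges, List.cons_append, List.cons.injEq] at hL
      obtain ⟨h1, h2⟩ := hL
      obtain ⟨a, b, ε, h⟩ := ih h2 (fun p hp => hE₁ p (List.mem_cons_of_mem _ hp))
      refine ⟨(if t.2.1 then D 1 t.1 (edgeSource θ n t.1 t.2.1)
        else (D 1 t.1 (edgeSource θ n t.1 t.2.1))⁻¹) * f t.2.2 * a, b, ε, fun g => ?_⟩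
      have : D g t.1 (edgeSource θ n t.1 t.2.1) = D 1 t.1 (edgeSource θ n t.1 t.2.1) := by
        have := hE₁ e' List.mem_cons_self g
        rwa [← h1] at this
      rw [pathVal, h, this]
      simp only [mul_assoc]

theorem existsUnique_pathVal_eq_one {θ : X → I} (D : Γ → X → I → Γ) (f : H →* Γ) {n : I}
    {L : List (X × Bool × H)} {E₁ E₂ : List (X × I)} {e : X × I}
    (hL : pathEdges θ n L = E₁ ++ e :: E₂) (he : ∀ g, D g e.1 e.2 = g)
    (hE : ∀ p ∈ E₁ ++ E₂, ∀ g, D g p.1 p.2 = D 1 p.1 p.2) :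
    ∃! g, pathVal θ (D g) f n L = 1 := by
  obtain ⟨a, b, ε, h⟩ := exists_pathVal_eq D f hL he
    (fun p hp => hE p (List.mem_append_left _ hp)) (fun p hp => hE p (List.mem_append_right _ hp))
  simp only [h]
  cases ε
  · refine ⟨b * a, by simp, fun g hg => ?_⟩
    simp only [Bool.false_eq_true, if_false] at hg
    have : g = b * a := by
      have h1 : g⁻¹ = a⁻¹ * b⁻¹ := by
        rw [eq_inv_mul_iff_mul_eq, eq_inv_iff_mul_eq_one]; exact hg
      rw [← inv_inv g, h1]; simp
    exact this
  · refine ⟨a⁻¹ * b⁻¹, by simp, fun g hg => ?_⟩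
    simp only [if_true] at hg
    rw [eq_inv_mul_iff_mul_eq, eq_inv_iff_mul_eq_one]
    exact hg

/-- The translation action of `I` on functions on `I`. -/
def shiftAut (I Γ : Type*) [AddCommGroup I] [Group Γ] : Multiplicative I →* MulAut (I → Γ) where
  toFun m :=
    { toFun := fun u n => u (n + m.toAdd)
      invFun := fun u n => u (n - m.toAdd)
      left_inv := fun u => by ext; simp
      right_inv := fun u => by ext; simp
      map_mul' := fun _ _ => rfl }
  map_one' := by ext; simp
  map_mul' a b := by
    ext u n
    simp only [toAdd_mul, MulEquiv.coe_mk, Equiv.coe_fn_mk, MulAut.mul_apply]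
    rw [add_assoc]

/-- The homomorphism into the unrestricted wreath product `Γ ≀ I` recording the values of all
paths. -/
def pathHom (θ : X → I) (D : X → I → Γ) (f : H →* Γ) :
    Coprod H (FreeGroup X) →* (I → Γ) ⋊[shiftAut I Γ] Multiplicative I :=
  Coprod.lift (SemidirectProduct.inl.comp (MonoidHom.mk' (fun h _ => f h) (by intros; ext; simp)))
    (FreeGroup.lift fun x => ⟨D x, Multiplicative.ofAdd (θ x)⟩)

theorem pathHom_inl (θ : X → I) (D : X → I → Γ) (f : H →* Γ) (h : H) :
    pathHom θ D f (Coprod.inl h) = SemidirectProduct.inl fun _ => f h := rfl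

theorem pathHom_relWord (θ : X → I) (D : X → I → Γ) (f : H →* Γ) (L : List (X × Bool × H)) :
    pathHom θ D f (relWord L) =
      ⟨fun n => pathVal θ D f n L, Multiplicative.ofAdd (pathWeight θ L)⟩ := by
  induction L with
  | nil =>
    simp only [relWord, List.map_nil, List.prod_nil, map_one]
    rfl
  | cons t L ih =>
    have e : relWord (t :: L) =
        Coprod.inr (FreeGroup.mk [(t.1, t.2.1)]) * Coprod.inl t.2.2 * relWord L := by
      simp [relWord]
    rw [e, map_mul, ih, map_mul, pathHom_inl]
    obtain ⟨x, ε, h⟩ := t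
    have hx : pathHom θ D f (Coprod.inr (FreeGroup.of x)) =
      ⟨D x, Multiplicative.ofAdd (θ x)⟩ := by simp [pathHom]
    cases ε
    · have : (FreeGroup.mk [(x, false)]) = (FreeGroup.of x)⁻¹ := rfl
      rw [this, map_inv, map_inv, hx]
      ext n
      · change (D x (n + -θ x))⁻¹ * f h * pathVal θ D f (n + (-θ x + 0)) L = _
        simp [pathVal, edgeSource, sub_eq_add_neg]
      · simp [pathWeight]
    · change pathHom θ D f (Coprod.inr (FreeGroup.of x)) * _ * _ = _
      rw [hx]
      ext n
      · change D x n * f h * pathVal θ D f (n + (θ x + 0)) L = _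
        simp [pathVal, edgeSource]
      · simp [pathWeight]

theorem exists_hom_relGroup {R : List (X × Bool × H)} (θ : X → I) (D : X → I → Γ) (f : H →* Γ)
    (hw : pathWeight θ R = 0) (hD : ∀ n, pathVal θ D f n R = 1) :
    ∃ F : relGroup R →* (I → Γ) ⋊[shiftAut I Γ] Multiplicative I,
      ∀ g : Coprod H (FreeGroup X), F (QuotientGroup.mk g) = pathHom θ D f g := by
  refine ⟨QuotientGroup.lift _ (pathHom θ D f) ?_, fun g => QuotientGroup.lift_mk' _ _ g⟩
  have : Subgroup.normalClosure {relWord R} ≤ (pathHom θ D f).ker := by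
    apply Subgroup.normalClosure_le_normal
    rw [Set.singleton_subset_iff, SetLike.mem_coe, MonoidHom.mem_ker, pathHom_relWord, hw]
    ext n
    · exact hD n
    · rfl
  exact this

theorem exists_eq_inl_mul_relWord (g : Coprod H (FreeGroup X)) :
    ∃ (h : H) (L : List (X × Bool × H)), g = Coprod.inl h * relWord L := by
  have hmul : ∀ (x : X) (ε : Bool) (h : H) (L : List (X × Bool × H)),
      Coprod.inr (FreeGroup.mk [(x, ε)]) * (Coprod.inl h * relWord L) =
        Coprod.inl 1 * relWord ((x, ε, h) :: L) := by
    intros; simp [relWord, mul_assoc]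
  induction g using Coprod.induction_on' with
  | one => exact ⟨1, [], by simp [relWord]⟩
  | inl_mul h g ih =>
    obtain ⟨h', L, rfl⟩ := ih
    exact ⟨h * h', L, by simp [mul_assoc]⟩
  | inr_mul w g ih =>
    induction w using FreeGroup.induction_on generalizing g with
    | C1 => simpa using ih
    | of x =>
      obtain ⟨h', L, rfl⟩ := ih
      exact ⟨_, _, hmul x true h' L⟩
    | inv_of x =>
      obtain ⟨h', L, rfl⟩ := ih
      exact ⟨_, _, hmul x false h' L⟩
    | mul a b iha ihb =>
      rw [map_mul, mul_assoc]
      exact iha _ (ihb _ ih)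

end Paths

section Recurrence

variable {Γ : Type*}

/-- A family of conditions `Rel n` on two-sided sequences such that `Rel n v` only involves the
values of `v` on `[n + lo, n + hi]`, and determines each of the extreme values from the others. -/
structure IsReversible (Rel : ℤ → (ℤ → Γ) → Prop) (lo hi : ℤ) : Prop where
  le : lo ≤ hi
  congr : ∀ n v v', (∀ i, n + lo ≤ i → i ≤ n + hi → v i = v' i) → Rel n v → Rel n v'
  existsUnique_hi : ∀ n v, ∃! g, Rel n (Function.update v (n + hi) g)
  existsUnique_lo : ∀ n v, ∃! g, Rel n (Function.update v (n + lo) g)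

namespace IsReversible

variable {Rel : ℤ → (ℤ → Γ) → Prop} {lo hi : ℤ}

theorem extend_one (hR : IsReversible Rel lo hi) {n₁ n₂ : ℤ} (h : n₁ ≤ n₂) (v : ℤ → Γ)
    (hv : ∀ n, n₁ ≤ n → n < n₂ → Rel n v) :
    ∃ v', (∀ n, n₁ - 1 ≤ n → n < n₂ + 1 → Rel n v') ∧
      ∀ i, n₁ + lo ≤ i → i < n₂ + hi → v' i = v i := by
  have hle := hR.le
  obtain ⟨g, hg, -⟩ := hR.existsUnique_hi n₂ v
  obtain ⟨g', hg', -⟩ := hR.existsUnique_lo (n₁ - 1) (Function.update v (n₂ + hi) g)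
  refine ⟨Function.update (Function.update v (n₂ + hi) g) (n₁ - 1 + lo) g',
    fun n h1 h2 => ?_, fun i h1 h2 => ?_⟩
  · rcases eq_or_ne n (n₁ - 1) with rfl | h3
    · exact hg'
    refine hR.congr n (Function.update v (n₂ + hi) g) _ (fun i h4 h5 => ?_) ?_
    · exact (Function.update_of_ne (by omega) _ _).symm
    rcases eq_or_ne n n₂ with rfl | h6
    · exact hg
    refine hR.congr n v _ (fun i h4 h5 => ?_) (hv n (by omega) (by omega))
    exact (Function.update_of_ne (by omega) _ _).symm
  · rw [Function.update_of_ne (by omega), Function.update_of_ne (by omega)]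

theorem exists_extension (hR : IsReversible Rel lo hi) {n₁ n₂ : ℤ} (h : n₁ ≤ n₂) (v : ℤ → Γ)
    (hv : ∀ n, n₁ ≤ n → n < n₂ → Rel n v) :
    ∃ v', (∀ n, Rel n v') ∧ ∀ i, n₁ + lo ≤ i → i < n₂ + hi → v' i = v i := by
  choose! next hnext1 hnext2 using fun (m : ℕ) (u : ℤ → Γ)
    (hu : ∀ n, n₁ - m ≤ n → n < n₂ + m → Rel n u) =>
      hR.extend_one (n₁ := n₁ - m) (n₂ := n₂ + m) (by omega) u hu
  let u : ℕ → ℤ → Γ := fun m => Nat.rec v (fun m w => next m w) m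
  have hu : ∀ m : ℕ, ∀ n, n₁ - m ≤ n → n < n₂ + m → Rel n (u m) := by
    intro m
    induction m with
    | zero => simpa [u] using hv
    | succ m ih =>
      intro n h1 h2
      exact hnext1 m (u m) ih n (by push_cast at h1; omega) (by push_cast at h2; omega)
  have hst : ∀ m k : ℕ, ∀ i, n₁ - m + lo ≤ i → i < n₂ + m + hi → u (m + k) i = u m i := by
    intro m k i h1 h2
    induction k with
    | zero => rfl
    | succ k ih =>
      rw [← ih]
      exact hnext2 (m + k) (u (m + k)) (hu _) i (by push_cast; omega) (by push_cast; omega)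
  let b : ℤ → ℕ := fun i => i.natAbs + n₁.natAbs + n₂.natAbs + lo.natAbs + hi.natAbs + 1
  have hb : ∀ (m : ℕ) (i : ℤ), n₁ - m + lo ≤ i → i < n₂ + m + hi → u (b i) i = u m i := by
    intro m i h1 h2
    rw [← hst m (b i) i h1 h2, add_comm m, hst (b i) m i] <;> simp only [b] <;> omega
  refine ⟨fun i => u (b i) i, fun n => ?_, fun i h1 h2 => ?_⟩
  · let m : ℕ := n.natAbs + n₁.natAbs + n₂.natAbs + 1
    refine hR.congr n (u m) _ (fun i h1 h2 => ?_) (hu m n ?_ ?_)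
    · exact (hb m i (by simp only [m]; omega) (by simp only [m]; omega)).symm
    · simp only [m]; omega
    · simp only [m]; omega
  · exact hb 0 i (by push_cast; omega) (by push_cast; omega)

theorem eq_of_agree (hR : IsReversible Rel lo hi) {v v' : ℤ → Γ} (hv : ∀ n, Rel n v)
    (hv' : ∀ n, Rel n v') (h : ∀ i, lo ≤ i → i < hi → v i = v' i) : v = v' := by
  have key : ∀ m : ℕ, ∀ i, lo - m ≤ i → i < hi + m → v i = v' i := by
    intro m
    induction m with
    | zero => simpa using h
    | succ m ih =>
      intro i h1 h2
      push_cast at h1 h2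
      by_cases h3 : i = hi + m
      · have hm : (m : ℤ) + hi = i := by omega
        refine (hR.existsUnique_hi m v').unique
          (hR.congr m v _ (fun j h4 h5 => ?_) (hv m)) ?_
        · by_cases h6 : j = i
          · subst h6; rw [← hm, Function.update_self]
          · rw [Function.update_of_ne (by omega)]
            exact ih j (by omega) (by omega)
        · rw [hm, Function.update_eq_self]; exact hv' m
      by_cases h3' : i = lo - (m + 1)
      · have hm : -((m : ℤ) + 1) + lo = i := by omega
        refine (hR.existsUnique_lo (-(m + 1)) v').unique
          (hR.congr _ v _ (fun j h4 h5 => ?_) (hv _)) ?_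
        · by_cases h6 : j = i
          · subst h6; rw [← hm, Function.update_self]
          · rw [Function.update_of_ne (by omega)]
            exact ih j (by omega) (by omega)
        · rw [hm, Function.update_eq_self]; exact hv' _
      exact ih i (by omega) (by omega)
  funext i
  exact key (i.natAbs + lo.natAbs + hi.natAbs + 1) i (by omega) (by omega)

theorem exists_period [Finite Γ] (hR : IsReversible Rel lo hi) {P : ℕ}
    (hper : ∀ n v, Rel (n + P) v → Rel n fun i => v (i + P)) {v : ℤ → Γ} (hv : ∀ n, Rel n v) :
    ∃ k : ℕ, 0 < k ∧ ∀ i, v (i + (k * P : ℕ)) = v i := by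
  have hsol : ∀ k : ℕ, ∀ n, Rel n fun i => v (i + (k * P : ℕ)) := by
    intro k
    induction k with
    | zero => simpa using hv
    | succ k ih =>
      intro n
      have := hper n _ (ih (n + P))
      convert this using 3
      push_cast
      ring
  obtain ⟨k, k', hne, hkk⟩ := Finite.exists_ne_map_eq_of_infinite
    fun (k : ℕ) (j : Set.Ico lo hi) => v (j + (k * P : ℕ))
  wlog hlt : k < k' generalizing k k'
  · exact this k' k hne.symm hkk.symm (by omega)
  have := hR.eq_of_agree (hsol k) (hsol k') fun i h1 h2 => congrFun hkk ⟨i, h1, h2⟩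
  refine ⟨k' - k, by omega, fun i => ?_⟩
  have h2 := congrFun this (i - (k * P : ℕ))
  simp only [sub_add_cancel] at h2
  rw [h2]
  congr 1
  obtain ⟨d, rfl⟩ := Nat.exists_eq_add_of_lt hlt
  have : k + d + 1 - k = d + 1 := by omega
  rw [this]
  push_cast
  ring

end IsReversible

end Recurrence

section UniqueMaxMin

variable {X H : Type*}

/-- `e` occurs exactly once in `E`, and it is the largest with respect to `r` among the edges in
`E` with the same label. -/
def IsExtremalEdge {I : Type*} (r : I → I → Prop) (E : List (X × I)) (e : X × I) : Prop :=
  ∃ E₁ E₂, E = E₁ ++ e :: E₂ ∧ ∀ p ∈ E₁ ++ E₂, p.1 = e.1 → r p.2 e.2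

theorem isExtremalEdge_getElem {I : Type*} {r : I → I → Prop} {E : List (X × I)} {k : ℕ}
    (hk : k < E.length)
    (h : ∀ j (hj : j < E.length), j ≠ k → (E[j]).1 = (E[k]).1 → r (E[j]).2 (E[k]).2) :
    IsExtremalEdge r E E[k] := by
  refine ⟨E.take k, E.drop (k + 1), ?_, ?_⟩
  · rw [← List.drop_eq_getElem_cons hk, List.take_append_drop]
  · intro p hp
    rcases List.mem_append.1 hp with hp | hp
    · obtain ⟨j, hj, rfl⟩ := List.mem_take_iff_getElem.1 hp
      exact h j (by omega) (by omega)
    · obtain ⟨j, hj, rfl⟩ := List.mem_drop_iff_getElem.1 hp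
      exact h _ (by omega) (by omega)

theorem phiW_cons_succ (θ : X → ℤ) (p : X × Bool) (W : List (X × Bool)) (j : ℕ) :
    phiW θ (p :: W) (j + 1) = (if p.2 then θ p.1 else -θ p.1) + phiW θ W j := by
  simp [phiW]

theorem phiW_succ (θ : X → ℤ) (W : List (X × Bool)) (j : ℕ) (hj : j < W.length) :
    phiW θ W (j + 1) = phiW θ W j + if W[j].2 then θ W[j].1 else -θ W[j].1 := by
  simp only [phiW, List.take_add_one, List.getElem?_eq_getElem hj, Option.toList_some,
    List.map_append, List.sum_append, List.map_cons, List.map_nil, List.sum_singleton]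

theorem length_pathEdges {I : Type*} [AddCommGroup I] (θ : X → I) (n : I)
    (R : List (X × Bool × H)) : (pathEdges θ n R).length = R.length := by
  induction R generalizing n with
  | nil => rfl
  | cons t R ih => simp [pathEdges, ih]

theorem pathEdges_getElem (θ : X → ℤ) (n : ℤ) (R : List (X × Bool × H)) (j : ℕ)
    (hj : j < R.length) (hj' : j < (pathEdges θ n R).length) :
    (pathEdges θ n R)[j] =
      (R[j].1, edgeSource θ (n + phiW θ (skel R) j) R[j].1 R[j].2.1) := by
  induction R generalizing n j with
  | nil => simp at hj
  | cons t R ih =>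
    cases j with
    | zero => simp [pathEdges, phiW]
    | succ j =>
      simp only [List.length_cons, Nat.add_lt_add_iff_right] at hj
      simp only [pathEdges, List.getElem_cons_succ]
      rw [ih _ _ hj]
      simp only [skel, List.map_cons, phiW_cons_succ]
      rw [← add_assoc]

theorem pathWeight_eq_phiW (θ : X → ℤ) (R : List (X × Bool × H)) :
    pathWeight θ R = phiW θ (skel R) (skel R).length := by
  simp only [pathWeight, phiW, List.take_length]
  simp [skel, Function.comp_def]

theorem phiW_eq_of_ne_succIdx {θ : X → ℤ} {W : List (X × Bool)} (hθ : IsAdmissible θ W)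
    (k j : Fin W.length) (hk : (W.get k).1 ≠ (W.get (succIdx W k)).1)
    (hj : (W.get j).1 = (W.get k).1) :
    ∃ j' : Fin W.length, j' ≠ k ∧ phiW θ W j = phiW θ W (j' + 1) := by
  have hne : succIdx W k ≠ j := by
    rintro rfl
    exact hk hj.symm
  have hpos := k.pos
  obtain ⟨j, hjl⟩ := j
  cases j with
  | zero =>
    refine ⟨⟨W.length - 1, by omega⟩, ?_, ?_⟩
    · rintro rfl
      apply hne
      ext
      simp only [succIdx]
      rw [Nat.sub_add_cancel hpos, Nat.mod_self]
    · simp only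
      rw [Nat.sub_add_cancel hpos, hθ]
      simp [phiW]
  | succ j =>
    refine ⟨⟨j, by omega⟩, ?_, rfl⟩
    rintro rfl
    apply hne
    ext
    simp only [succIdx]
    rw [Nat.mod_eq_of_lt hjl]

theorem HasUniqueMaxMin.exists_isExtremalEdge {R : List (X × Bool × H)}
    (hR : HasUniqueMaxMin (skel R)) :
    ∃ θ : X → ℤ, pathWeight θ R = 0 ∧
      (∃ e, IsExtremalEdge (· < ·) (pathEdges θ 0 R) e) ∧
      ∃ e, IsExtremalEdge (· > ·) (pathEdges θ 0 R) e := by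
  obtain ⟨θ, -, -, -, hadm, k, l, hk, hl, hk', hl'⟩ := hR
  have hlen : (pathEdges θ 0 R).length = (skel R).length := by simp [length_pathEdges, skel]
  have key : ∀ j (hj : j < (skel R).length),
      ((pathEdges θ 0 R)[j]'(by omega)).1 = ((skel R).get ⟨j, hj⟩).1 ∧
      ((((pathEdges θ 0 R)[j]'(by omega)).2 = phiW θ (skel R) j ∧
        phiW θ (skel R) (j + 1) = phiW θ (skel R) j + θ ((skel R).get ⟨j, hj⟩).1) ∨
      (((pathEdges θ 0 R)[j]'(by omega)).2 = phiW θ (skel R) (j + 1) ∧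
        phiW θ (skel R) (j + 1) = phiW θ (skel R) j - θ ((skel R).get ⟨j, hj⟩).1)) := by
    intro j hj
    have hj' : j < R.length := by simpa [skel] using hj
    rw [pathEdges_getElem θ 0 R j hj', phiW_succ _ _ _ hj]
    have e : (skel R)[j] = (R[j].1, R[j].2.1) := by simp [skel]
    refine ⟨by simp [e], ?_⟩
    simp only [List.get_eq_getElem, e, edgeSource]
    by_cases h : R[j].2.1 = true
    · left; simp [h]
    · right; simp [h, sub_eq_add_neg]
  refine ⟨θ, by rw [pathWeight_eq_phiW, hadm], ⟨_, isExtremalEdge_getElem (k := k) (by omega) ?_⟩,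
    ⟨_, isExtremalEdge_getElem (k := l) (by omega) ?_⟩⟩
  · intro j hj hjk hjx
    obtain ⟨h1, h2⟩ := key j (by omega)
    obtain ⟨h3, h4⟩ := key k k.2
    have hx : ((skel R).get ⟨j, by omega⟩).1 = ((skel R).get k).1 := by rw [← h1, hjx, h3]
    rw [hx] at h2
    obtain ⟨j', hj', h5⟩ := phiW_eq_of_ne_succIdx hadm k ⟨j, by omega⟩ hk' hx
    have h6 := hk j' hj'
    have h7 := hk ⟨j, by omega⟩ (by intro h; exact hjk (congrArg Fin.val h))
    simp only [Fin.eta] at h2 h4 h5 h6 h7 ⊢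
    omega
  · intro j hj hjk hjx
    obtain ⟨h1, h2⟩ := key j (by omega)
    obtain ⟨h3, h4⟩ := key l l.2
    have hx : ((skel R).get ⟨j, by omega⟩).1 = ((skel R).get l).1 := by rw [← h1, hjx, h3]
    rw [hx] at h2
    obtain ⟨j', hj', h5⟩ := phiW_eq_of_ne_succIdx hadm l ⟨j, by omega⟩ hl' hx
    have h6 := hl j' hj'
    have h7 := hl ⟨j, by omega⟩ (by intro h; exact hjk (congrArg Fin.val h))
    simp only [Fin.eta] at h2 h4 h5 h6 h7 ⊢
    omega

end UniqueMaxMin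

section Solutions

variable {X H Γ : Type*} [Group H] [Group Γ]

/-- Edge values in which the letters `x` with `pos x = some δ` are read off from the sequence `v`
with delay `δ`, while the other letters are given by `D`. -/
def delayedData (pos : X → Option ℤ) (D : X → ℤ → Γ) (v : ℤ → Γ) (x : X) (n : ℤ) : Γ :=
  match pos x with
  | some δ => v (n - δ)
  | none => D x n

omit [Group Γ] in
theorem delayedData_some {pos : X → Option ℤ} (D : X → ℤ → Γ) (v : ℤ → Γ) {x : X} {δ : ℤ}
    (h : pos x = some δ) (n : ℤ) : delayedData pos D v x n = v (n - δ) := by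
  simp [delayedData, h]

omit [Group Γ] in
theorem delayedData_none {pos : X → Option ℤ} (D : X → ℤ → Γ) (v : ℤ → Γ) {x : X}
    (h : pos x = none) (n : ℤ) : delayedData pos D v x n = D x n := by
  simp [delayedData, h]

omit [Group H] in
theorem mem_pathEdges_iff {I : Type*} [AddCommGroup I] {θ : X → I} {n : I}
    {R : List (X × Bool × H)} {p : X × I} :
    p ∈ pathEdges θ n R ↔ ∃ q ∈ pathEdges θ 0 R, (q.1, n + q.2) = p := by
  rw [pathEdges_eq_map, List.mem_map]

theorem existsUnique_delayedData {θ : X → ℤ} {R : List (X × Bool × H)} (f : H →* Γ)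
    (D : X → ℤ → Γ) {pos : X → Option ℤ} {e : X × ℤ} {E₁ E₂ : List (X × ℤ)} {δ m : ℤ}
    (hE : pathEdges θ 0 R = E₁ ++ e :: E₂) (he : pos e.1 = some δ) (hm : e.2 - δ = m)
    (hE' : ∀ p ∈ E₁ ++ E₂, ∀ δ', pos p.1 = some δ' → p.2 - δ' ≠ m) (n : ℤ) (v : ℤ → Γ) :
    ∃! g, pathVal θ (delayedData pos D (Function.update v (n + m) g)) f n R = 1 := by
  have hn : pathEdges θ n R = E₁.map (fun p => (p.1, n + p.2)) ++ (e.1, n + e.2) ::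
      E₂.map (fun p => (p.1, n + p.2)) := by
    rw [pathEdges_eq_map, hE, List.map_append, List.map_cons]
  refine existsUnique_pathVal_eq_one
    (fun g => delayedData pos D (Function.update v (n + m) g)) f hn (fun g => ?_) ?_
  · rw [delayedData_some _ _ he, show n + e.2 - δ = n + m by omega, Function.update_self]
  · rw [← List.map_append]
    intro p hp g
    obtain ⟨q, hq, rfl⟩ := List.mem_map.1 hp
    cases h : pos q.1 with
    | none => simp only [delayedData_none _ _ h]
    | some δ' =>
      have := hE' q hq δ' h
      simp only [delayedData_some _ _ h]
      rw [Function.update_of_ne (by omega), Function.update_of_ne (by omega)]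

theorem isReversible_delayedData {θ : X → ℤ} {R : List (X × Bool × H)} (f : H →* Γ)
    (D : X → ℤ → Γ) {pos : X → Option ℤ} {e e' : X × ℤ} {δ δ' lo hi : ℤ}
    (he : pos e.1 = some δ) (hhi : e.2 - δ = hi) (he' : pos e'.1 = some δ') (hlo : e'.2 - δ' = lo)
    (htop : ∃ E₁ E₂, pathEdges θ 0 R = E₁ ++ e :: E₂ ∧
      ∀ p ∈ E₁ ++ E₂, ∀ d, pos p.1 = some d → p.2 - d < hi)
    (hbot : ∃ E₁ E₂, pathEdges θ 0 R = E₁ ++ e' :: E₂ ∧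
      ∀ p ∈ E₁ ++ E₂, ∀ d, pos p.1 = some d → lo < p.2 - d) :
    IsReversible (fun n v => pathVal θ (delayedData pos D v) f n R = 1) lo hi := by
  obtain ⟨E₁, E₂, hE, hE'⟩ := htop
  obtain ⟨F₁, F₂, hF, hF'⟩ := hbot
  have hle_hi : ∀ p ∈ pathEdges θ 0 R, ∀ d, pos p.1 = some d → p.2 - d ≤ hi := by
    intro p hp d hd
    rw [hE, List.mem_append, List.mem_cons] at hp
    rcases hp with hp | rfl | hp
    · exact (hE' p (List.mem_append_left _ hp) d hd).le
    · rw [he, Option.some.injEq] at hd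
      omega
    · exact (hE' p (List.mem_append_right _ hp) d hd).le
  have hlo_le : ∀ p ∈ pathEdges θ 0 R, ∀ d, pos p.1 = some d → lo ≤ p.2 - d := by
    intro p hp d hd
    rw [hF, List.mem_append, List.mem_cons] at hp
    rcases hp with hp | rfl | hp
    · exact (hF' p (List.mem_append_left _ hp) d hd).le
    · rw [he', Option.some.injEq] at hd
      omega
    · exact (hF' p (List.mem_append_right _ hp) d hd).le
  refine ⟨?_, fun n v v' h hv => ?_, ?_, ?_⟩
  · have := hlo_le e (by rw [hE]; simp) δ he
    omega
  · rw [← hv]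
    refine pathVal_congr fun p hp => ?_
    obtain ⟨q, hq, rfl⟩ := mem_pathEdges_iff.1 hp
    cases hd : pos q.1 with
    | none => simp only [delayedData_none _ _ hd]
    | some d =>
      have h1 := hle_hi q hq d hd
      have h2 := hlo_le q hq d hd
      simp only [delayedData_some _ _ hd]
      exact (h _ (by omega) (by omega)).symm
  · exact existsUnique_delayedData f D hE he hhi fun p hp d hd => (hE' p hp d hd).ne
  · exact existsUnique_delayedData f D hF he' hlo fun p hp d hd => (hF' p hp d hd).ne'

/-- Partial solutions of the relations `R` at the vertices in `[-C, C)` extend to solutions at all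
vertices, which are moreover periodic when `Γ` is finite. -/
theorem exists_solution {θ : X → ℤ} {R : List (X × Bool × H)}
    (hmax : ∃ e, IsExtremalEdge (· < ·) (pathEdges θ 0 R) e)
    (hmin : ∃ e, IsExtremalEdge (· > ·) (pathEdges θ 0 R) e) (f : H →* Γ) (D : X → ℤ → Γ)
    (B C : ℕ) (hB : ∀ p ∈ pathEdges θ 0 R, |p.2| ≤ B)
    (hD : ∀ n : ℤ, -C ≤ n → n < C → pathVal θ D f n R = 1) :
    ∃ D' : X → ℤ → Γ, (∀ n, pathVal θ D' f n R = 1) ∧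
      (∀ x (n : ℤ), |n| + B < C → D' x n = D x n) ∧
      (Finite Γ → ∀ P : ℕ, 0 < P → (∀ x n, D x (n + P) = D x n) →
        ∃ N : ℕ, 0 < N ∧ ∀ x n, D' x (n + N) = D' x n) := by
  classical
  obtain ⟨⟨a, s⟩, E₁, E₂, hE, hE'⟩ := hmax
  obtain ⟨⟨c, t⟩, F₁, F₂, hF, hF'⟩ := hmin
  have hs := abs_le.1 (hB (a, s) (by rw [hE]; simp))
  have ht := abs_le.1 (hB (c, t) (by rw [hF]; simp))
  have hBE : ∀ p ∈ E₁ ++ E₂, -(B : ℤ) ≤ p.2 ∧ p.2 ≤ B := fun p hp => abs_le.1 (hB p (by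
    rw [hE]; simp only [List.mem_append, List.mem_cons] at hp ⊢; tauto))
  have hBF : ∀ p ∈ F₁ ++ F₂, -(B : ℤ) ≤ p.2 ∧ p.2 ≤ B := fun p hp => abs_le.1 (hB p (by
    rw [hF]; simp only [List.mem_append, List.mem_cons] at hp ⊢; tauto))
  simp only at hs ht
  obtain ⟨J, hJ0, hJ1⟩ : ∃ J : ℤ, (a = c → J = 0) ∧ (a ≠ c → J = 2 * (B + C) + 1) := by
    by_cases h : a = c
    · exact ⟨0, by simp, fun h' => absurd h h'⟩
    · exact ⟨_, fun h' => absurd h' h, fun _ => rfl⟩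
  let pos : X → Option ℤ := fun x => if x = a then some 0 else if x = c then some J else none
  have posa : pos a = some 0 := by simp [pos]
  have posc : pos c = some J := by
    by_cases h : a = c
    · simp [pos, h, hJ0 h]
    · simp [pos, Ne.symm h]
  have pos_eq : ∀ x d, pos x = some d → (x = a ∧ d = 0) ∨ (x = c ∧ d = J) := by
    intro x d hd
    simp only [pos] at hd
    split_ifs at hd with h1 h2
    · exact Or.inl ⟨h1, by simpa using hd.symm⟩
    · exact Or.inr ⟨h2, by simpa using hd.symm⟩
  have hrev : IsReversible (fun n v => pathVal θ (delayedData pos D v) f n R = 1) (t - J) s := by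
    refine isReversible_delayedData f D (e := (a, s)) (e' := (c, t)) posa (by simp) posc rfl
      ⟨E₁, E₂, hE, fun p hp d hd => ?_⟩ ⟨F₁, F₂, hF, fun p hp d hd => ?_⟩
    · have hb := hBE p hp
      rcases pos_eq _ _ hd with ⟨h1, rfl⟩ | ⟨h1, rfl⟩
      · have := hE' p hp h1
        simp only at this
        omega
      · by_cases hac : a = c
        · have := hE' p hp (h1.trans hac.symm)
          have := hJ0 hac
          simp only at *
          omega
        · have := hJ1 hac
          omega
    · have hb := hBF p hp
      rcases pos_eq _ _ hd with ⟨h1, rfl⟩ | ⟨h1, rfl⟩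
      · by_cases hac : a = c
        · have := hF' p hp (h1.trans hac)
          have := hJ0 hac
          simp only at *
          omega
        · have := hJ1 hac
          omega
      · have := hF' p hp h1
        simp only at this
        omega
  let v₀ : ℤ → Γ := fun n => if -((B : ℤ) + C) ≤ n ∨ a = c then D a n else D c (n + J)
  have hv₀ : ∀ x (n : ℤ), -((B : ℤ) + C) ≤ n → n ≤ B + C → delayedData pos D v₀ x n = D x n := by
    intro x n h1 h2
    cases hd : pos x with
    | none => rw [delayedData_none _ _ hd]
    | some d =>
      rw [delayedData_some _ _ hd]
      rcases pos_eq _ _ hd with ⟨rfl, rfl⟩ | ⟨rfl, rfl⟩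
      · simp only [v₀]
        rw [sub_zero, if_pos (Or.inl h1)]
      · by_cases hac : a = x
        · simp [v₀, hac, hJ0 hac]
        · have := hJ1 hac
          simp only [v₀, hac, or_false]
          rw [if_neg (by omega), sub_add_cancel]
  obtain ⟨v, hv, hvv⟩ := hrev.exists_extension (n₁ := -C) (n₂ := C) (by omega) v₀ (by
    intro n h1 h2
    rw [← hD n h1 h2]
    refine pathVal_congr fun p hp => ?_
    obtain ⟨q, hq, rfl⟩ := mem_pathEdges_iff.1 hp
    have := abs_le.1 (hB q hq)
    exact hv₀ _ _ (by omega) (by omega))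
  refine ⟨delayedData pos D v, hv, fun x n hn => ?_, fun hfin P hP hper => ?_⟩
  · have h1 : -((C : ℤ) - B) < n ∧ n < C - B := abs_lt.1 (by omega)
    rw [← hv₀ x n (by omega) (by omega)]
    have hJ : 0 ≤ J := by
      by_cases hac : a = c
      · exact (hJ0 hac).ge
      · have := hJ1 hac; omega
    cases hd : pos x with
    | none => simp only [delayedData_none _ _ hd]
    | some d =>
      simp only [delayedData_some _ _ hd]
      have hdJ : 0 ≤ d ∧ d ≤ J := by
        rcases pos_eq _ _ hd with ⟨-, rfl⟩ | ⟨-, rfl⟩ <;> omega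
      exact hvv _ (by omega) (by omega)
  · have hdel : ∀ (w : ℤ → Γ) x n,
        delayedData pos D w x (n + P) = delayedData pos D (fun i => w (i + P)) x n := by
      intro w x n
      cases hd : pos x with
      | none => simp only [delayedData_none _ _ hd, hper]
      | some d =>
        simp only [delayedData_some _ _ hd]
        congr 1
        ring
    obtain ⟨k, hk, hkv⟩ := hrev.exists_period (P := P) (by
      intro n w hw
      rw [← hw]
      simp only [pathVal_add_right, hdel]) hv
    have hper' : ∀ (j : ℕ) x n, D x (n + (j * P : ℕ)) = D x n := by
      intro j x n
      induction j with
      | zero => simp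
      | succ j ih =>
        calc D x (n + ((j + 1) * P : ℕ)) = D x (n + (j * P : ℕ) + P) := by
              congr 1
              push_cast
              ring
          _ = D x n := by rw [hper, ih]
    refine ⟨k * P, Nat.mul_pos hk hP, fun x n => ?_⟩
    cases hd : pos x with
    | none => simp only [delayedData_none _ _ hd, hper']
    | some d =>
      simp only [delayedData_some _ _ hd]
      rw [← hkv (n - d)]
      congr 1
      ring

end Solutions

section Lifting

variable {X H : Type*} [Group H]

theorem exists_forall_abs_le (E : List (X × ℤ)) : ∃ B : ℕ, ∀ p ∈ E, |p.2| ≤ B := by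
  induction E with
  | nil => exact ⟨0, by simp⟩
  | cons e E ih =>
    obtain ⟨B, hB⟩ := ih
    refine ⟨B + e.2.natAbs, List.forall_mem_cons.2 ⟨by push_cast; omega, fun p hp => ?_⟩⟩
    have := hB p hp
    have := abs_nonneg e.2
    push_cast
    omega

/-- The projection from the free product onto the group of a relative presentation. -/
def toRelGroup (R : List (X × Bool × H)) : Coprod H (FreeGroup X) →* relGroup R :=
  QuotientGroup.mk' _

theorem toRelGroup_relWord (R : List (X × Bool × H)) : toRelGroup R (relWord R) = 1 :=
  (QuotientGroup.eq_one_iff _).2 (Subgroup.subset_normalClosure rfl)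

/-- The natural homomorphism from the coefficient group of a relative presentation whose skeleton
has the unique max-min property is injective. -/
theorem natHom_injective {R : List (X × Bool × H)} (hR : HasUniqueMaxMin (skel R)) :
    Function.Injective (natHom R) := by
  obtain ⟨θ, hw, hmax, hmin⟩ := hR.exists_isExtremalEdge
  obtain ⟨B, hB⟩ := exists_forall_abs_le (pathEdges θ 0 R)
  obtain ⟨D, hD, -⟩ := exists_solution hmax hmin (MonoidHom.id H) (fun _ _ => 1) B 0 hB
    (fun n h1 h2 => by simp at h1 h2; omega)
  obtain ⟨F, hF⟩ := exists_hom_relGroup θ D (MonoidHom.id H) hw hD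
  rw [injective_iff_map_eq_one]
  intro h hh
  have h1 : F (natHom R h) = SemidirectProduct.inl fun _ => h := hF (Coprod.inl h)
  rw [hh, map_one] at h1
  exact (congrFun (congrArg SemidirectProduct.left h1) 0).symm

/-- The relations at finitely many consecutive vertices can be solved in the free product by
lifts of the generators. -/
theorem exists_lift_solution {θ : X → ℤ} {R : List (X × Bool × H)}
    (hmax : ∃ e, IsExtremalEdge (· < ·) (pathEdges θ 0 R) e) (n₀ : ℤ) (m : ℕ) :
    ∃ D : X → ℤ → Coprod H (FreeGroup X),
      (∀ x n, toRelGroup R (D x n) = toRelGroup R (Coprod.inr (FreeGroup.of x))) ∧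
      ∀ n, n₀ ≤ n → n < n₀ + m → pathVal θ D Coprod.inl n R = 1 := by
  classical
  obtain ⟨⟨a, s⟩, E₁, E₂, hE, hE'⟩ := hmax
  simp only at hE'
  induction m with
  | zero => exact ⟨fun x _ => Coprod.inr (FreeGroup.of x), fun _ _ => rfl, fun n _ _ => by omega⟩
  | succ m ih =>
    obtain ⟨D, hD, hD'⟩ := ih
    set π := toRelGroup R
    have hn : pathEdges θ (n₀ + m) R = E₁.map (fun p => (p.1, n₀ + m + p.2)) ++
        (a, n₀ + m + s) :: E₂.map (fun p => (p.1, n₀ + m + p.2)) := by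
      rw [pathEdges_eq_map, hE, List.map_append, List.map_cons]
    let upd {Γ : Type _} (D : X → ℤ → Γ) (g : Γ) : X → ℤ → Γ :=
      Function.update D a (Function.update (D a) (n₀ + m + s) g)
    have upd_self {Γ : Type _} (D : X → ℤ → Γ) (g : Γ) : upd D g a (n₀ + m + s) = g := by
      simp [upd]
    have upd_of_ne {Γ : Type _} (D : X → ℤ → Γ) (g : Γ) (x : X) (n : ℤ)
        (h : x = a → n ≠ n₀ + m + s) : upd D g x n = D x n := by
      by_cases hx : x = a
      · subst hx
        simp [upd, h rfl]
      · simp [upd, hx]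
    have hupd {Γ : Type _} (D : X → ℤ → Γ) : ∀ p ∈ E₁.map (fun p => (p.1, n₀ + m + p.2)) ++
        E₂.map (fun p => (p.1, n₀ + m + p.2)), ∀ g g', upd D g p.1 p.2 = upd D g' p.1 p.2 := by
      rw [← List.map_append]
      intro p hp g g'
      obtain ⟨q, hq, rfl⟩ := List.mem_map.1 hp
      have : q.1 = a → n₀ + m + q.2 ≠ n₀ + m + s := fun h => by have := hE' q hq h; omega
      rw [upd_of_ne _ _ _ _ this, upd_of_ne _ _ _ _ this]
    obtain ⟨g, hg, -⟩ := existsUnique_pathVal_eq_one (upd D) Coprod.inl hn (upd_self D)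
      fun p hp g => hupd D p hp g 1
    have hconst : pathVal θ (fun x _ => π (Coprod.inr (FreeGroup.of x))) (π.comp Coprod.inl)
        (n₀ + m) R = 1 := by
      rw [pathVal_const]
      exact toRelGroup_relWord R
    have hmap : ∀ x n, π (upd D g x n) =
        upd (fun x _ => π (Coprod.inr (FreeGroup.of x))) (π g) x n := by
      intro x n
      by_cases h : x = a ∧ n = n₀ + m + s
      · obtain ⟨rfl, rfl⟩ := h
        rw [upd_self, upd_self]
      · rw [upd_of_ne _ _ _ _ (by tauto), upd_of_ne _ _ _ _ (by tauto), hD]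
    have hπg : π g = π (Coprod.inr (FreeGroup.of a)) := by
      refine (existsUnique_pathVal_eq_one (upd fun x _ => π (Coprod.inr (FreeGroup.of x)))
        (π.comp Coprod.inl) hn (upd_self _) fun p hp g => hupd _ p hp g 1).unique ?_ ?_
      · have := congrArg π hg
        rw [map_pathVal, map_one] at this
        simpa only [hmap] using this
      · refine Eq.trans (pathVal_congr fun p hp => ?_) hconst
        by_cases h : p.1 = a ∧ p.2 = n₀ + m + s
        · obtain ⟨x, n⟩ := p
          obtain ⟨rfl, rfl⟩ := h
          rw [upd_self]
        · rw [upd_of_ne _ _ _ _ (by tauto)]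
    refine ⟨upd D g, fun x n => ?_, fun n h1 h2 => ?_⟩
    · rw [hmap, hπg]
      by_cases h : x = a ∧ n = n₀ + m + s
      · obtain ⟨rfl, rfl⟩ := h
        rw [upd_self]
      · rw [upd_of_ne _ _ _ _ (by tauto)]
    · by_cases h : n = n₀ + m
      · rw [h]
        exact hg
      · push_cast at h2
        rw [← hD' n h1 (by omega)]
        refine pathVal_congr fun p hp => upd_of_ne _ _ _ _ fun hp' => ?_
        obtain ⟨q, hq, rfl⟩ := mem_pathEdges_iff.1 hp
        rw [hE, List.mem_append, List.mem_cons] at hq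
        have : q.2 ≤ s := by
          rcases hq with hq | rfl | hq
          · exact (hE' q (List.mem_append_left _ hq) hp').le
          · rfl
          · exact (hE' q (List.mem_append_right _ hq) hp').le
        simp only
        omega

end Lifting

section RelGroup

variable {X H : Type*} [Group H]

theorem exists_wrap (W : ℕ) : ∃ wrap : ℤ → ℤ, (∀ n : ℤ, |n| ≤ W → wrap n = n) ∧
    ∀ n, wrap (n + (2 * W + 1 : ℕ)) = wrap n := by
  refine ⟨fun n => (n + W) % (2 * W + 1 : ℕ) - W, fun n hn => ?_, fun n => ?_⟩
  · have := abs_le.1 hn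
    change (n + W) % (2 * W + 1 : ℕ) - W = n
    rw [Int.emod_eq_of_lt (by omega) (by push_cast; omega)]
    ring
  · simp only
    rw [add_right_comm, Int.add_emod_right]

/-- A group given by a relative presentation whose skeleton has the unique max-min property is
residually finite if its coefficient group is. -/
theorem residuallyFinite_relGroup {R : List (X × Bool × H)} (hR : HasUniqueMaxMin (skel R))
    (hH : ResiduallyFinite H) : ResiduallyFinite (relGroup R) := by
  intro g hg
  obtain ⟨θ, hw, hmax, hmin⟩ := hR.exists_isExtremalEdge
  obtain ⟨g, rfl⟩ := QuotientGroup.mk_surjective g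
  obtain ⟨h, L, rfl⟩ := exists_eq_inl_mul_relWord g
  obtain ⟨B, hB⟩ := exists_forall_abs_le (pathEdges θ 0 R ++ pathEdges θ 0 L)
  have hBR : ∀ p ∈ pathEdges θ 0 R, |p.2| ≤ B := fun p hp => hB p (List.mem_append_left _ hp)
  have hBL : ∀ p ∈ pathEdges θ 0 L, |p.2| ≤ B := fun p hp => hB p (List.mem_append_right _ hp)
  set C : ℕ := 2 * B + 1 with hC
  obtain ⟨D, hD, hDR⟩ := exists_lift_solution hmax (-C) (2 * C)
  have hne : (Coprod.inl h * pathVal θ D Coprod.inl 0 L : Coprod H (FreeGroup X)) ≠ 1 := by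
    intro h1
    apply hg
    change toRelGroup R (Coprod.inl h * relWord L) = 1
    rw [← map_one (toRelGroup R), ← h1, map_mul, map_mul, map_pathVal,
      ← pathVal_const (toRelGroup R) θ 0 L]
    simp only [hD]
  obtain ⟨Q, _, _, ρ, hρ⟩ := hH.coprod (residuallyFinite_freeGroup X) _ hne
  rw [map_mul, map_pathVal] at hρ
  obtain ⟨wrap, hwrap, hper⟩ := exists_wrap (C + B)
  obtain ⟨D', hD'R, hD', hD'per⟩ := exists_solution hmax hmin (ρ.comp Coprod.inl)
    (fun x n => ρ (D x (wrap n))) B C hBR (by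
      intro n h1 h2
      rw [← map_one ρ, ← hDR n h1 (by push_cast; omega), map_pathVal]
      refine pathVal_congr fun p hp => ?_
      obtain ⟨q, hq, rfl⟩ := mem_pathEdges_iff.1 hp
      have := abs_le.1 (hBR q hq)
      rw [hwrap _ (abs_le.2 (by push_cast; constructor <;> omega))])
  obtain ⟨N, hN, hD'N⟩ := hD'per inferInstance (2 * (C + B) + 1) (by omega)
    fun x n => by rw [hper]
  have : NeZero N := ⟨hN.ne'⟩
  have hmul : ∀ x (n : ℤ) (k : ℤ), D' x (n + N * k) = D' x n := by
    intro x n k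
    induction k with
    | zero => simp
    | succ k ih => rw [← ih, ← hD'N x (n + N * k)]; congr 1; ring
    | pred k ih => rw [← ih, ← hD'N]; congr 1; ring
  have hcast : ∀ x (n : ℤ), D' x (((n : ZMod N).val : ℕ) : ℤ) = D' x n := by
    intro x n
    rw [ZMod.val_intCast, ← hmul x (n % N) (n / N), Int.emod_add_mul_ediv]
  have hpath := pathVal_intCast N θ D' (fun x i => D' x (i.val : ℤ)) hcast (ρ.comp Coprod.inl)
  obtain ⟨F, hF⟩ := exists_hom_relGroup (R := R) (fun x => (θ x : ZMod N))
    (fun x i => D' x (i.val : ℤ)) (ρ.comp Coprod.inl)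
    (by rw [pathWeight_intCast, hw, Int.cast_zero])
    (fun n => by
      obtain ⟨n, rfl⟩ := ZMod.intCast_surjective n
      rw [hpath, hD'R])
  refine ⟨_, inferInstance, Finite.of_equiv _ SemidirectProduct.equivProd.symm, F, fun h1 => hρ ?_⟩
  have h2 : F (QuotientGroup.mk (Coprod.inl h * relWord L)) = _ := hF _
  rw [h1, map_mul, pathHom_inl, pathHom_relWord] at h2
  have h3 := congrFun (congrArg SemidirectProduct.left h2) ((0 : ℤ) : ZMod N)
  simp only [SemidirectProduct.mul_left, SemidirectProduct.left_inl, SemidirectProduct.right_inl,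
    map_one, MulAut.one_apply, Pi.mul_apply, hpath, SemidirectProduct.one_left,
    Pi.one_apply] at h3
  rw [h3, MonoidHom.comp_apply]
  congr 1
  refine pathVal_congr fun p hp => ?_
  have := hBL p hp
  rw [hD' _ _ (by omega), hwrap _ (by push_cast; omega)]

end RelGroup

section Substitution

variable {X Y H : Type*} [Group H]

theorem freeGroup_mk_false (x : X) : FreeGroup.mk [(x, false)] = (FreeGroup.of x)⁻¹ := rfl

theorem relWord_append (L L' : List (X × Bool × H)) :
    relWord (L ++ L') = relWord L * relWord L' := by
  simp [relWord]

theorem relWord_singleton (x : X) (ε : Bool) (h : H) :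
    relWord [(x, ε, h)] = Coprod.inr (FreeGroup.mk [(x, ε)]) * Coprod.inl h := by
  simp [relWord]

theorem map_substWord {Γ : Type*} [Group Γ] (π : Coprod H (FreeGroup (X ⊕ Y)) →* Γ)
    (q : FreeGroup (Option Y) →* Γ) {R : List (X × Bool × H)}
    (hz : π (coprodInlX (relWord R)) = q (FreeGroup.of none))
    (hy : ∀ y, π (Coprod.inr (FreeGroup.of (Sum.inr y))) = q (FreeGroup.of (some y)))
    (S : List (Option Y × Bool)) : π (substWord R S) = q (FreeGroup.mk S) := by
  induction S with
  | nil =>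
    rw [substWord, ← FreeGroup.one_eq_mk]
    simp
  | cons p S ih =>
    have e : (FreeGroup.mk (p :: S)) = FreeGroup.mk [p] * FreeGroup.mk S := by
      rw [FreeGroup.mul_mk]
      rfl
    rw [substWord, List.map_cons, List.prod_cons, ← substWord, e, map_mul, map_mul, ih]
    obtain ⟨_ | y, _ | _⟩ := p
    · simp [freeGroup_mk_false, hz]
    · simp [← FreeGroup.of.eq_1, hz]
    · simp [freeGroup_mk_false, hy]
    · simp [← FreeGroup.of.eq_1, hy]

/-- The relator `R z⁻¹` over the coefficient group `H ∗ K`. -/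
theorem exists_adjusted_relator {K : Type*} [Group K] (z : K) {R : List (X × Bool × H)}
    (hR : R ≠ []) : ∃ R' : List (X × Bool × Coprod H K), skel R' = skel R ∧
      relWord R' = Coprod.map Coprod.inl (MonoidHom.id _) (relWord R) *
        Coprod.inl (Coprod.inr z⁻¹) := by
  have key : ∀ R : List (X × Bool × H),
      relWord (R.map fun t => (t.1, t.2.1, (Coprod.inl t.2.2 : Coprod H K))) =
        Coprod.map Coprod.inl (MonoidHom.id _) (relWord R) := by
    intro R
    rw [relWord, relWord, map_list_prod, List.map_map, List.map_map]
    congr 2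
  rcases List.eq_nil_or_concat R with rfl | ⟨R, ⟨x, ε, h⟩, rfl⟩
  · exact absurd rfl hR
  · refine ⟨R.map (fun t => (t.1, t.2.1, Coprod.inl t.2.2)) ++
      [(x, ε, Coprod.inl h * Coprod.inr z⁻¹)], ?_, ?_⟩
    · simp [skel]
    · rw [List.concat_eq_append, relWord_append, relWord_append, key, map_mul, relWord_singleton,
        relWord_singleton]
      simp [mul_assoc]

end Substitution

section Isomorphism

variable {X Y H : Type*} [Group H]

/-- The projection from the free product onto the group obtained by substitution. -/
def toSubstGroup (R : List (X × Bool × H)) (S : List (Option Y × Bool)) :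
    Coprod H (FreeGroup (X ⊕ Y)) →* substGroup R S :=
  QuotientGroup.mk' _

theorem toSubstGroup_substWord (R : List (X × Bool × H)) (S : List (Option Y × Bool)) :
    toSubstGroup R S (substWord R S) = 1 :=
  (QuotientGroup.eq_one_iff _).2 (Subgroup.subset_normalClosure rfl)

/-- The projection from the free group onto the one-relator group. -/
def toOneRelatorGroup (S : List (Option Y × Bool)) : FreeGroup (Option Y) →* oneRelatorGroup S :=
  QuotientGroup.mk' _

theorem toOneRelatorGroup_mk (S : List (Option Y × Bool)) :
    toOneRelatorGroup S (FreeGroup.mk S) = 1 :=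
  (QuotientGroup.eq_one_iff _).2 (Subgroup.subset_normalClosure rfl)

theorem toRelGroup_comp_inl (R : List (X × Bool × H)) :
    (toRelGroup R).comp Coprod.inl = natHom R := rfl

/-- The universal property of a quotient by the normal closure of a single element. -/
theorem exists_hom_quotient_normalClosure {G Γ : Type*} [Group G] [Group Γ] {r : G} (φ : G →* Γ)
    (h : φ r = 1) : ∃ ψ : G ⧸ Subgroup.normalClosure {r} →* Γ,
      ψ.comp (QuotientGroup.mk' _) = φ :=
  ⟨QuotientGroup.lift _ φ (Subgroup.normalClosure_le_normal (Set.singleton_subset_iff.2 h)), rfl⟩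

/-- Substituting the relator `R` for `z` in `S` amounts to adjoining the letters of `R` to the
free product `H ∗ K` subject to the relation `R = z`. -/
theorem exists_hom_substGroup {R : List (X × Bool × H)} {S : List (Option Y × Bool)}
    {R' : List (X × Bool × Coprod H (oneRelatorGroup S))}
    (hR' : relWord R' = Coprod.map Coprod.inl (MonoidHom.id _) (relWord R) *
      Coprod.inl (Coprod.inr (toOneRelatorGroup S (FreeGroup.of none))⁻¹)) :
    ∃ (φ : substGroup R S →* relGroup R') (κ : oneRelatorGroup S →* substGroup R S),
      Function.Injective φ ∧
      φ.comp ((toSubstGroup R S).comp Coprod.inl) = (natHom R').comp Coprod.inl ∧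
      φ.comp κ = (natHom R').comp Coprod.inr := by
  let Φ : Coprod H (FreeGroup (X ⊕ Y)) →* relGroup R' :=
    Coprod.lift ((natHom R').comp Coprod.inl) (FreeGroup.lift (Sum.elim
      (fun x => toRelGroup R' (Coprod.inr (FreeGroup.of x)))
      fun y => natHom R' (Coprod.inr (toOneRelatorGroup S (FreeGroup.of (some y))))))
  have hΦ : Φ (coprodInlX (relWord R)) =
      natHom R' (Coprod.inr (toOneRelatorGroup S (FreeGroup.of none))) := by
    have h := toRelGroup_relWord R'
    rw [hR', map_mul, map_inv, map_inv, map_inv, mul_inv_eq_one] at h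
    refine Eq.trans ?_ h
    rw [← MonoidHom.comp_apply, coprodInlX, ← MonoidHom.comp_apply]
    congr 1
    ext <;> simp [Φ, ← toRelGroup_comp_inl, MonoidHom.comp_apply]
  obtain ⟨φ, hφ⟩ : ∃ φ : substGroup R S →* relGroup R', φ.comp (toSubstGroup R S) = Φ := by
    apply exists_hom_quotient_normalClosure
    rw [map_substWord _ (((natHom R').comp Coprod.inr).comp (toOneRelatorGroup S))]
    · rw [MonoidHom.comp_apply, toOneRelatorGroup_mk, map_one]
    · exact hΦ
    · simp [Φ]
  obtain ⟨κ, hκ⟩ : ∃ κ : oneRelatorGroup S →* substGroup R S, κ.comp (toOneRelatorGroup S) =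
      FreeGroup.lift fun o => o.elim (toSubstGroup R S (coprodInlX (relWord R)))
        fun y => toSubstGroup R S (Coprod.inr (FreeGroup.of (Sum.inr y))) := by
    apply exists_hom_quotient_normalClosure
    rw [← map_substWord (toSubstGroup R S) _ _ _ S, toSubstGroup_substWord]
    · simp
    · simp
  obtain ⟨ψ, hψ⟩ : ∃ ψ : relGroup R' →* substGroup R S, ψ.comp (toRelGroup R') =
      Coprod.lift (Coprod.lift ((toSubstGroup R S).comp Coprod.inl) κ) (FreeGroup.lift
        fun x => toSubstGroup R S (Coprod.inr (FreeGroup.of (Sum.inl x)))) := by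
    apply exists_hom_quotient_normalClosure
    have h : κ (toOneRelatorGroup S (FreeGroup.of none)) =
        toSubstGroup R S (coprodInlX (relWord R)) := by
      rw [← MonoidHom.comp_apply, hκ]
      simp
    rw [hR', map_mul, Coprod.lift_apply_inl, Coprod.lift_apply_inr, map_inv, h, mul_inv_eq_one,
      ← MonoidHom.comp_apply, ← MonoidHom.comp_apply, coprodInlX]
    congr 1
    ext <;> simp
  have hφ' := fun w => DFunLike.congr_fun hφ w
  have hκ' := fun w => DFunLike.congr_fun hκ w
  have hψ' := fun w => DFunLike.congr_fun hψ w
  simp only [MonoidHom.comp_apply] at hφ' hκ' hψ'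
  have hψn : ∀ k, ψ (natHom R' k) = Coprod.lift ((toSubstGroup R S).comp Coprod.inl) κ k := by
    intro k
    rw [← toRelGroup_comp_inl, MonoidHom.comp_apply, hψ', Coprod.lift_apply_inl]
  refine ⟨φ, κ, ?_, ?_, ?_⟩
  · have h : (ψ.comp φ).comp (toSubstGroup R S) = toSubstGroup R S := by
      rw [MonoidHom.comp_assoc]
      ext a
      · simp [hφ', hψn, Φ]
      · obtain x | y := a
        · simp [hφ', hψ', Φ]
        · simp [hφ', hψn, hκ', Φ]
    refine Function.LeftInverse.injective (g := ψ) fun g => ?_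
    obtain ⟨g, rfl⟩ := QuotientGroup.mk_surjective g
    exact DFunLike.congr_fun h g
  · ext h
    simp [hφ', Φ]
  · have h : (φ.comp κ).comp (toOneRelatorGroup S) =
        ((natHom R').comp Coprod.inr).comp (toOneRelatorGroup S) := by
      ext o
      obtain _ | y := o
      · simp [hκ', hφ', hΦ]
      · simp [hκ', hφ', Φ]
    ext k
    obtain ⟨k, rfl⟩ := QuotientGroup.mk_surjective k
    exact DFunLike.congr_fun h k

end Isomorphism

/-- **Theorem 2** (Substitution Theorem). Let `K = ⟨y, z; S(y,z)⟩` be a one-relator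
group and `P = ⟨x, H; R⟩` an `M_H`-presentation. Then the group defined by the
relative presentation `⟨x, y, H; S(y, R)⟩`, obtained by substituting `R` for every
occurrence of `z^{±1}` in `S`, is residually finite iff both `H` and `K` are. -/
theorem substGroup_residuallyFinite_iff {X Y H : Type*} [Group H]
    (R : List (X × Bool × H)) (hP : HasUniqueMaxMin (skel R))
    (S : List (Option Y × Bool)) (hS : S ≠ []) :
    ResiduallyFinite (substGroup R S) ↔
      (ResiduallyFinite H ∧ ResiduallyFinite (oneRelatorGroup S)) := by
  have hR : R ≠ [] := by
    rintro rfl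
    obtain ⟨θ, h, -⟩ := hP
    exact h rfl
  obtain ⟨R', hskel, hR'⟩ := exists_adjusted_relator (H := H)
    (toOneRelatorGroup S (FreeGroup.of none)) hR
  rw [← hskel] at hP
  obtain ⟨φ, κ, hφ, hH, hK⟩ := exists_hom_substGroup hR'
  refine ⟨fun h => ⟨.of_injective ((toSubstGroup R S).comp Coprod.inl) ?_ h,
    .of_injective κ ?_ h⟩,
    fun h => .of_injective φ hφ (residuallyFinite_relGroup hP (h.1.coprod h.2))⟩
  · apply Function.Injective.of_comp (f := φ)
    rw [← MonoidHom.coe_comp, hH, MonoidHom.coe_comp]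
    exact (natHom_injective hP).comp Coprod.inl_injective
  · apply Function.Injective.of_comp (f := φ)
    rw [← MonoidHom.coe_comp, hK, MonoidHom.coe_comp]
    exact (natHom_injective hP).comp Coprod.inr_injective
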